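/- Let u be a d×d real totally nonnegative upper triangular unipotent matrix that is not totally positive. Then there exists k with 1 ≤ k ≤ d−1 such that the image under u (acting as a linear map on ℝ^d) of the span of the last k standard basis vectors, together with the span of the last d−k standard basis vectors, does not span ℝ^d; that is, Submodule.map u (span{e_{d−k}, …, e_{d−1}}) ⊔ span{e_k, …, e_{d−1}} ≠ ⊤ (indices 0-based). -/

import Mathlib

open Matrix

/-- An upper triangular unipotent `d × d` real matrix: all entries below the
diagonal vanish and all diagonal entries equal `1`. -/
def UTUnipotent {d : ℕ} (u : Matrix (Fin d) (Fin d) ℝ) : Prop :=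
  (∀ i j : Fin d, (j : ℕ) < (i : ℕ) → u i j = 0) ∧ ∀ i : Fin d, u i i = 1

/-- A (square, upper triangular unipotent) matrix is totally positive if all of
its non-trivial minors are positive: for all strictly increasing index tuples
`I J : Fin k → Fin d` with `I p ≤ J p` for all `p`, the corresponding minor is
positive. -/
def TotallyPositive {d : ℕ} (u : Matrix (Fin d) (Fin d) ℝ) : Prop :=
  ∀ k : ℕ, 1 ≤ k → k ≤ d → ∀ I J : Fin k → Fin d,
    StrictMono I → StrictMono J → (∀ p, I p ≤ J p) → 0 < (u.submatrix I J).det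

/-- A (square, upper triangular unipotent) matrix is totally nonnegative if all
of its non-trivial minors are nonnegative. -/
def TotallyNonneg {d : ℕ} (u : Matrix (Fin d) (Fin d) ℝ) : Prop :=
  ∀ k : ℕ, 1 ≤ k → k ≤ d → ∀ I J : Fin k → Fin d,
    StrictMono I → StrictMono J → (∀ p, I p ≤ J p) → 0 ≤ (u.submatrix I J).det

/-- The `d`-th upper triangular Pascal matrix: its `(i,j)` entry (`0`-indexed)
is `C(j,i)` when `i ≤ j` and `0` otherwise. -/
def pascal (d : ℕ) : Matrix (Fin d) (Fin d) ℝ :=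
  Matrix.of fun i j => if (i : ℕ) ≤ (j : ℕ) then ((j : ℕ).choose (i : ℕ) : ℝ) else 0

/-- A tuple `I : Fin k → Fin d` is consecutive if `I p = I 0 + p` for all `p`
(stated symmetrically so that it also makes sense for `k = 0`). -/
def Consecutive {d k : ℕ} (I : Fin k → Fin d) : Prop :=
  ∀ p q : Fin k, (I p : ℕ) + (q : ℕ) = (I q : ℕ) + (p : ℕ)

/-- The row indices `(0, 1, …, k-1)` of the top-right corner `k × k` minor. -/
def cornerI {d : ℕ} (k : ℕ) (hk : k ≤ d) : Fin k → Fin d :=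
  fun p => ⟨(p : ℕ), lt_of_lt_of_le p.isLt hk⟩

/-- The column indices `(d-k, d-k+1, …, d-1)` of the top-right corner `k × k`
minor. -/
def cornerJ {d : ℕ} (k : ℕ) (hk : k ≤ d) : Fin k → Fin d :=
  fun p => ⟨d - k + (p : ℕ), by have h := p.isLt; omega⟩

/-- The span of the last `k` standard basis vectors `e_{d-k}, …, e_{d-1}` of
`ℝ^d` (indices `0`-based). -/
def lastBasisSpan (d k : ℕ) : Submodule ℝ (Fin d → ℝ) :=
  Submodule.span ℝ
    ((fun i : Fin d => (Pi.single i (1 : ℝ) : Fin d → ℝ)) ''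
      {i : Fin d | d - k ≤ (i : ℕ)})

/-- All minors of `A`, of every size, are nonnegative. -/
def AllMinorsNonneg {m n : ℕ} (A : Matrix (Fin m) (Fin n) ℝ) : Prop :=
  ∀ (k : ℕ) (I : Fin k → Fin m) (J : Fin k → Fin n),
    StrictMono I → StrictMono J → 0 ≤ (A.submatrix I J).det

/-- The reflection of a square matrix in its antidiagonal. -/
def antitranspose {d : ℕ} (A : Matrix (Fin d) (Fin d) ℝ) : Matrix (Fin d) (Fin d) ℝ :=
  (A.submatrix Fin.rev Fin.rev)ᵀ

/-- Conjugation of an index tuple by the order reversals of its domain and codomain. -/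
def revConj {d k : ℕ} (I : Fin k → Fin d) : Fin k → Fin d :=
  fun p => (I p.rev).rev

theorem revConj_revConj {d k : ℕ} (I : Fin k → Fin d) : revConj (revConj I) = I := by
  funext p
  simp [revConj]

theorem StrictMono.revConj {d k : ℕ} {I : Fin k → Fin d} (hI : StrictMono I) :
    StrictMono (revConj I) := fun _ _ h =>
  Fin.rev_lt_rev.2 (hI (Fin.rev_lt_rev.2 h))

theorem Consecutive.revConj {d k : ℕ} {I : Fin k → Fin d} (hI : Consecutive I) :
    Consecutive (revConj I) := by
  intro p q
  have h := hI p.rev q.rev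
  simp only [_root_.revConj, Fin.val_rev] at h ⊢
  omega

theorem det_antitranspose_submatrix {d k : ℕ} (A : Matrix (Fin d) (Fin d) ℝ)
    (I J : Fin k → Fin d) :
    ((antitranspose A).submatrix I J).det = (A.submatrix (revConj J) (revConj I)).det := by
  rw [← det_submatrix_equiv_self Fin.revPerm (A.submatrix _ _), ← det_transpose]
  congr 1
  ext p q
  simp [antitranspose, revConj]

theorem det_antitranspose {d : ℕ} (A : Matrix (Fin d) (Fin d) ℝ) :
    (antitranspose A).det = A.det := by
  rw [antitranspose, det_transpose]
  exact det_submatrix_equiv_self Fin.revPerm A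

namespace AllMinorsNonneg

theorem submatrix {m n m' n' : ℕ} {A : Matrix (Fin m) (Fin n) ℝ} (hA : AllMinorsNonneg A)
    {f : Fin m' → Fin m} {g : Fin n' → Fin n} (hf : StrictMono f) (hg : StrictMono g) :
    AllMinorsNonneg (A.submatrix f g) := fun k I J hI hJ => by
  rw [submatrix_submatrix]
  exact hA k _ _ (hf.comp hI) (hg.comp hJ)

theorem antitranspose {d : ℕ} {A : Matrix (Fin d) (Fin d) ℝ} (hA : AllMinorsNonneg A) :
    AllMinorsNonneg (antitranspose A) := fun k I J hI hJ => by
  rw [det_antitranspose_submatrix]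
  exact hA k _ _ hJ.revConj hI.revConj

theorem det_nonneg {n : ℕ} {A : Matrix (Fin n) (Fin n) ℝ} (hA : AllMinorsNonneg A) :
    0 ≤ A.det := hA n id id strictMono_id strictMono_id

/-- Deleting the first row and the first column of a nonsingular totally nonnegative matrix
leaves a nonsingular matrix. -/
theorem det_submatrix_succ_pos {n : ℕ} {A : Matrix (Fin (n + 1)) (Fin (n + 1)) ℝ}
    (hA : AllMinorsNonneg A) (hdet : 0 < A.det) :
    0 < (A.submatrix Fin.succ Fin.succ).det := by
  rcases n with _ | n
  · simp
  set C := A.submatrix Fin.succ Fin.succ with hC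
  refine (hA.submatrix Fin.strictMono_succ Fin.strictMono_succ).det_nonneg.lt_of_ne' fun hC0 => ?_
  obtain ⟨j, hj⟩ : ∃ j : Fin (n + 2), (A.submatrix Fin.succ j.succAbove).det ≠ 0 := by
    by_contra! h
    rw [det_succ_row_zero] at hdet
    simp [h] at hdet
  obtain ⟨j, rfl⟩ : ∃ j', j = Fin.succ j' := by
    refine Fin.exists_succ_eq.2 ?_ |>.imp fun _ => Eq.symm
    rintro rfl
    exact hj (by simpa [hC] using hC0)
  have hδ : 0 < (A.submatrix Fin.succ j.succ.succAbove).det :=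
    (hA.submatrix Fin.strictMono_succ (Fin.strictMono_succAbove _)).det_nonneg.lt_of_ne' hj
  set δ := (A.submatrix Fin.succ j.succ.succAbove).det with hδ_def
  have hσ : ∑ i, C.adjugate j i * A i.succ 0 = (-1) ^ (j : ℕ) * δ := by
    rw [hδ_def, det_succ_column_zero, Finset.mul_sum]
    refine Finset.sum_congr rfl fun i _ => ?_
    rw [adjugate_fin_succ_eq_det_submatrix, submatrix_submatrix, submatrix_submatrix]
    have : j.succ.succAbove ∘ Fin.succ = Fin.succ ∘ j.succAbove := by
      funext q
      simp
    rw [this, submatrix_apply, Fin.succ_succAbove_zero]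
    ring
  have hv : (A.det • vecCons 0 (C.adjugate j) - ((-1) ^ (j : ℕ) * δ) • A.adjugate 0) = 0 := by
    refine eq_zero_of_vecMul_eq_zero hdet.ne' ?_
    rw [sub_vecMul, smul_vecMul, smul_vecMul]
    have h1 : A.adjugate 0 ᵥ* A = Pi.single 0 A.det := by
      have := congrFun (adjugate_mul A) 0
      funext l
      have h := congrFun this l
      rw [mul_apply_eq_vecMul] at h
      rw [h]
      simp [Matrix.one_apply, Pi.single_apply, eq_comm]
    have h2 : (vecCons 0 (C.adjugate j)) ᵥ* A = Pi.single 0 ((-1) ^ (j : ℕ) * δ) := by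
      funext l
      refine Fin.cases ?_ (fun l => ?_) l
      · simp [vecMul, dotProduct, Fin.sum_univ_succ, hσ]
      · have h := congrFun (congrFun (adjugate_mul C) j) l
        rw [hC0, zero_smul] at h
        simpa [vecMul, dotProduct, Fin.sum_univ_succ, mul_apply, hC] using h
    rw [h1, h2]
    funext l
    refine Fin.cases ?_ (fun l => ?_) l
    · simp [mul_comm]
    · simp
  have hα : ∀ i : Fin (n + 2), (A.submatrix i.succAbove Fin.succ).det = 0 := by
    intro i
    refine Fin.cases (by simpa [hC] using hC0) (fun i => ?_) i
    have h := congrFun hv i.succ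
    simp only [Pi.sub_apply, Pi.smul_apply, cons_val_succ, smul_eq_mul, Pi.zero_apply,
      adjugate_fin_succ_eq_det_submatrix, Fin.val_succ, Fin.val_zero, add_zero,
      Fin.succAbove_zero] at h
    have hb := (hA.submatrix (Fin.strictMono_succ.comp (Fin.strictMono_succAbove i))
      (Fin.strictMono_succ.comp (Fin.strictMono_succAbove j))).det_nonneg
    have ha := (hA.submatrix (Fin.strictMono_succAbove i.succ) Fin.strictMono_succ).det_nonneg
    rw [hC, submatrix_submatrix] at h
    set a := (A.submatrix i.succ.succAbove Fin.succ).det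
    set b := (A.submatrix (Fin.succ ∘ i.succAbove) (Fin.succ ∘ j.succAbove)).det
    have hsq : ((-1 : ℝ) ^ ((i : ℕ) + j)) * (-1) ^ ((i : ℕ) + j) = 1 := by
      rw [← mul_pow]; simp
    have h' : A.det * b + δ * a = 0 := by
      have : (-1 : ℝ) ^ ((i : ℕ) + j) * (A.det * b + δ * a) = 0 := by
        rw [← h]; ring
      exact (mul_eq_zero.1 this).resolve_left (by positivity)
    have : δ * a = 0 := by nlinarith [mul_nonneg hdet.le hb, mul_nonneg hδ.le ha]
    exact (mul_eq_zero.1 this).resolve_left hδ.ne'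
  rw [det_succ_column_zero] at hdet
  simp [hα] at hdet

/-- Deleting the last row and the last column of a nonsingular totally nonnegative matrix
leaves a nonsingular matrix. -/
theorem det_submatrix_castSucc_pos {n : ℕ} {A : Matrix (Fin (n + 1)) (Fin (n + 1)) ℝ}
    (hA : AllMinorsNonneg A) (hdet : 0 < A.det) :
    0 < (A.submatrix Fin.castSucc Fin.castSucc).det := by
  have h := hA.antitranspose.det_submatrix_succ_pos (by rwa [det_antitranspose])
  rw [det_antitranspose_submatrix] at h
  have : revConj (Fin.succ : Fin n → Fin (n + 1)) = Fin.castSucc := by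
    funext p
    simp [revConj, Fin.rev_succ]
  rwa [this] at h

/-- The contiguous principal minors of a nonsingular totally nonnegative matrix are positive. -/
theorem det_principal_pos {n k : ℕ} {A : Matrix (Fin n) (Fin n) ℝ} (hA : AllMinorsNonneg A)
    (hdet : 0 < A.det) {I : Fin k → Fin n} (hI : Consecutive I) :
    0 < (A.submatrix I I).det := by
  induction n with
  | zero =>
    rcases k with _ | k
    · simp
    · exact (I 0).elim0
  | succ n ih =>
    by_cases h0 : ∀ p, I p ≠ 0
    · obtain ⟨I', rfl⟩ : ∃ I' : Fin k → Fin n, I = Fin.succ ∘ I' :=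
        ⟨fun p => (I p).pred (h0 p), by funext p; simp⟩
      have := ih (hA.submatrix Fin.strictMono_succ Fin.strictMono_succ)
        (hA.det_submatrix_succ_pos hdet) (I := I') (fun p q => by
          have := hI p q
          simp only [Function.comp_apply, Fin.val_succ] at this
          omega)
      rwa [submatrix_submatrix] at this
    by_cases h1 : ∀ p, I p ≠ Fin.last n
    · obtain ⟨I', rfl⟩ : ∃ I' : Fin k → Fin n, I = Fin.castSucc ∘ I' :=
        ⟨fun p => (I p).castPred (h1 p), by funext p; simp⟩
      have := ih (hA.submatrix Fin.strictMono_castSucc Fin.strictMono_castSucc)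
        (hA.det_submatrix_castSucc_pos hdet) (I := I') (fun p q => by
          have := hI p q
          simp only [Function.comp_apply, Fin.val_castSucc] at this
          omega)
      rwa [submatrix_submatrix] at this
    push Not at h0 h1
    obtain ⟨p, hp⟩ := h0
    obtain ⟨q, hq⟩ := h1
    have hpq := hI p q
    have hp0 := hI p ⟨0, p.pos⟩
    have hql := hI q ⟨k - 1, by have := p.pos; omega⟩
    have hlt := (I ⟨k - 1, by have := p.pos; omega⟩).isLt
    rw [hp] at hpq hp0
    rw [hq] at hpq hql
    simp only [Fin.val_zero, Fin.val_last] at hpq hp0 hql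
    have hk : k = n + 1 := by omega
    subst hk
    have : I = id := by
      funext r
      have := hI r p
      rw [hp] at this
      simp only [Fin.val_zero] at this
      exact Fin.ext (by simp only [id]; omega)
    simpa [this] using hdet

/-- In a totally nonnegative matrix with one more row than columns, positivity of the maximal
minor omitting the last row, and of one smaller minor, forces positivity of the maximal minor
omitting an interior row. -/
theorem det_submatrix_succAbove_pos {n : ℕ} {M : Matrix (Fin (n + 2)) (Fin (n + 1)) ℝ}
    (hM : AllMinorsNonneg M) {t : Fin (n + 2)} (ht0 : t ≠ 0) (htl : t ≠ Fin.last _)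
    (h1 : 0 < (M.submatrix Fin.castSucc id).det)
    (h2 : 0 < (M.submatrix (t.succAbove ∘ Fin.succ) Fin.succ).det) :
    0 < (M.submatrix t.succAbove id).det := by
  have relation : ∀ {m : ℕ} (B : Matrix (Fin (m + 1)) (Fin m) ℝ) (j : Fin m),
      ∑ i : Fin (m + 1), (-1) ^ (i : ℕ) * (B.submatrix i.succAbove id).det * B i j = 0 := by
    intro m B j
    have h : (Matrix.of fun i => (Fin.cons (B i j) (B i) : Fin (m + 1) → ℝ)).det = 0 :=
      det_zero_of_column_eq (Fin.succ_ne_zero j).symm (by simp)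
    rw [det_succ_column_zero] at h
    rw [← h]
    refine Finset.sum_congr rfl fun i _ => ?_
    have : (Matrix.of fun i => (Fin.cons (B i j) (B i) : Fin (m + 1) → ℝ)).submatrix
        i.succAbove Fin.succ = B.submatrix i.succAbove id := by
      ext; simp
    rw [this]
    simp only [of_apply, Fin.cons_zero]
    ring
  refine (hM.submatrix (Fin.strictMono_succAbove t) strictMono_id).det_nonneg.lt_of_ne' fun h0 => ?_
  set N := M.submatrix t.succAbove Fin.succ with hN
  set x : Fin (n + 1) → ℝ := fun i => (-1) ^ (t.succAbove i : ℕ) *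
    (M.submatrix (t.succAbove i).succAbove id).det with hx
  set y : Fin (n + 1) → ℝ := fun i => (-1) ^ (i : ℕ) * (N.submatrix i.succAbove id).det with hy
  have hxN : x ᵥ* N = 0 := by
    funext j
    have h := relation M j.succ
    rw [Fin.sum_univ_succAbove _ t, h0] at h
    simpa [vecMul, dotProduct, hN, hx] using h
  have hyN : y ᵥ* N = 0 := by
    funext j
    exact relation N j
  have hN0 : N.submatrix (Fin.succAbove 0) id = M.submatrix (t.succAbove ∘ Fin.succ) Fin.succ := by
    rw [hN, submatrix_submatrix]; simp
  have hw : (fun i : Fin n => (y 0 • x - x 0 • y) i.succ) = 0 := by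
    refine eq_zero_of_vecMul_eq_zero (M := N.submatrix (Fin.succAbove 0) id)
      (by rw [hN0]; exact h2.ne') ?_
    have h : (y 0 • x - x 0 • y) ᵥ* N = 0 := by
      rw [sub_vecMul, smul_vecMul, smul_vecMul, hxN, hyN]; simp
    funext j
    have h := congrFun h j
    simp only [vecMul, dotProduct] at h
    rw [Fin.sum_univ_succ] at h
    simpa [mul_comm, vecMul, dotProduct] using h
  have hlast : y 0 * x (Fin.last n) = x 0 * y (Fin.last n) := by
    rcases n with _ | n
    · simp [mul_comm]
    · have := congrFun hw (Fin.last n)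
      simp only [Pi.sub_apply, Pi.smul_apply, smul_eq_mul, Fin.succ_last, Pi.zero_apply] at this
      linarith
  have hy0 : 0 < y 0 := by
    rw [← hN0] at h2
    simpa only [hy, Fin.val_zero, pow_zero, one_mul] using h2
  have hx0 : 0 ≤ x 0 := by
    have := (hM.submatrix (Fin.strictMono_succAbove 0) strictMono_id).det_nonneg
    simpa [hx, Fin.succAbove_ne_zero_zero ht0] using this
  have hxl : x (Fin.last n) = (-1) ^ (n + 1) * (M.submatrix Fin.castSucc id).det := by
    simp [hx, Fin.succAbove_ne_last_last htl]
  have hyl : y (Fin.last n) = (-1) ^ n * (N.submatrix Fin.castSucc id).det := by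
    simp [hy]
  have hNl := ((hM.submatrix (Fin.strictMono_succAbove t) Fin.strictMono_succ).submatrix
    Fin.strictMono_castSucc strictMono_id).det_nonneg
  rw [hxl, hyl] at hlast
  have h : (-1 : ℝ) ^ n * (y 0 * (M.submatrix Fin.castSucc id).det
      + x 0 * (N.submatrix Fin.castSucc id).det) = 0 := by
    linear_combination -hlast
  have h := (mul_eq_zero.1 h).resolve_left (by positivity)
  linarith [mul_pos hy0 h1, mul_nonneg hx0 hNl]

end AllMinorsNonneg

theorem consecutive_of_succ {d n : ℕ} {I : Fin (n + 1) → Fin d}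
    (h : ∀ i : Fin n, (I i.succ : ℕ) = I i.castSucc + 1) : Consecutive I := by
  have key : ∀ p : Fin (n + 1), (I p : ℕ) = I 0 + p := by
    intro p
    induction p using Fin.induction with
    | zero => simp
    | succ i ih => rw [h, ih]; simp [add_assoc]
  intro p q
  rw [key p, key q]
  omega

/-- Positivity of nontrivial minors propagates from consecutive to arbitrary row sets. -/
theorem AllMinorsNonneg.det_pos_of_consecutive_rows {d n : ℕ} {u : Matrix (Fin d) (Fin d) ℝ}
    (hu : AllMinorsNonneg u)
    (ih : ∀ I J : Fin n → Fin d, StrictMono I → StrictMono J → (∀ p, I p ≤ J p) →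
      0 < (u.submatrix I J).det)
    {J : Fin (n + 1) → Fin d} (hJ : StrictMono J)
    (hcons : ∀ I : Fin (n + 1) → Fin d, StrictMono I → Consecutive I → (∀ p, I p ≤ J p) →
      0 < (u.submatrix I J).det)
    (I : Fin (n + 1) → Fin d) (hI : StrictMono I) (hIJ : ∀ p, I p ≤ J p) :
    0 < (u.submatrix I J).det := by
  induction hN : (I (Fin.last n) : ℕ) using Nat.strong_induction_on generalizing I with
  | _ N rec =>
  subst hN
  by_cases hc : Consecutive I
  · exact hcons I hI hc hIJ
  obtain ⟨i, hi⟩ : ∃ i : Fin n, (I i.succ : ℕ) ≠ I i.castSucc + 1 := by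
    by_contra! h
    exact hc (consecutive_of_succ h)
  have hlt : (I i.castSucc : ℕ) < I i.succ := hI Fin.castSucc_lt_succ
  set x : Fin d := ⟨I i.castSucc + 1, by omega⟩ with hx
  set t : Fin (n + 2) := i.succ.castSucc with ht
  set I' : Fin (n + 2) → Fin d := t.insertNth x I with hI'
  have hI'mono : StrictMono I' := by
    refine (Fin.strictMono_insertNth_iff t x I).2 ⟨hI, fun j hj => ?_, fun j hj => ?_⟩
    · have hji : j ≤ i.castSucc := by
        simp only [ht, Fin.lt_def, Fin.le_def, Fin.val_castSucc, Fin.val_succ] at hj ⊢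
        omega
      have := hI.monotone hji
      simp only [hx, Fin.lt_def, Fin.le_def] at this ⊢
      omega
    · have hji : i.succ ≤ j := by
        simp only [ht, Fin.le_def, Fin.val_castSucc, Fin.val_succ] at hj ⊢
        omega
      have := hI.monotone hji
      simp only [hx, Fin.lt_def, Fin.le_def] at this ⊢
      omega
  have hI't : I' ∘ t.succAbove = I := by
    funext p
    simp [hI']
  have ht0 : t ≠ 0 := by simp [ht, Fin.ext_iff]
  have htl : t ≠ Fin.last _ := by
    have := i.isLt
    simp only [ht, ne_eq, Fin.ext_iff, Fin.val_castSucc, Fin.val_succ, Fin.val_last]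
    omega
  have hle : ∀ p, I' (Fin.castSucc p) ≤ I p := fun p => by
    rw [← hI't]
    refine hI'mono.monotone ?_
    rcases Fin.castSucc_lt_or_lt_succ t p with h | h
    · rw [Fin.succAbove_of_castSucc_lt _ _ h]
    · rw [Fin.succAbove_of_lt_succ _ _ h]
      exact Fin.castSucc_lt_succ.le
  have hM := (hu.submatrix hI'mono hJ).det_submatrix_succAbove_pos ht0 htl ?_ ?_
  · rwa [submatrix_submatrix, hI't] at hM
  · rw [submatrix_submatrix]
    refine rec _ ?_ _ (hI'mono.comp Fin.strictMono_castSucc) (fun p => (hle p).trans (hIJ p)) rfl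
    rw [← hI't]
    exact hI'mono (by
      rw [Fin.succAbove_ne_last_last htl]
      exact Fin.castSucc_lt_last _)
  · rw [submatrix_submatrix, ← Function.comp_assoc, hI't]
    exact ih _ _ (hI.comp Fin.strictMono_succ) (hJ.comp Fin.strictMono_succ) fun p => hIJ _

/-- Positivity of nontrivial minors propagates from consecutive to arbitrary column sets. -/
theorem AllMinorsNonneg.det_pos_of_consecutive_cols {d n : ℕ} {u : Matrix (Fin d) (Fin d) ℝ}
    (hu : AllMinorsNonneg u)
    (ih : ∀ I J : Fin n → Fin d, StrictMono I → StrictMono J → (∀ p, I p ≤ J p) →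
      0 < (u.submatrix I J).det)
    {I : Fin (n + 1) → Fin d} (hI : StrictMono I)
    (hcons : ∀ J : Fin (n + 1) → Fin d, StrictMono J → Consecutive J → (∀ p, I p ≤ J p) →
      0 < (u.submatrix I J).det)
    (J : Fin (n + 1) → Fin d) (hJ : StrictMono J) (hIJ : ∀ p, I p ≤ J p) :
    0 < (u.submatrix I J).det := by
  have h := hu.antitranspose.det_pos_of_consecutive_rows (J := revConj I)
    (fun I J hI hJ hIJ => ?_) hI.revConj (fun J hJ hJc hJI => ?_) (revConj J) hJ.revConj
    fun p => Fin.rev_le_rev.2 (hIJ _)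
  · rwa [det_antitranspose_submatrix, revConj_revConj, revConj_revConj] at h
  · rw [det_antitranspose_submatrix]
    exact ih _ _ hJ.revConj hI.revConj fun p => Fin.rev_le_rev.2 (hIJ _)
  · rw [det_antitranspose_submatrix, revConj_revConj]
    refine hcons _ hJ.revConj hJc.revConj fun p => ?_
    have := Fin.rev_le_rev.2 (hJI p.rev)
    simpa [revConj] using this

/-- The minors of an upper triangular matrix that are not nontrivial vanish. -/
theorem UTUnipotent.det_submatrix_eq_zero {d k : ℕ} {u : Matrix (Fin d) (Fin d) ℝ}
    (hu : UTUnipotent u) {I J : Fin k → Fin d} (hI : StrictMono I) (hJ : StrictMono J)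
    {p : Fin k} (hp : J p < I p) : (u.submatrix I J).det = 0 := by
  rw [det_apply]
  refine Finset.sum_eq_zero fun σ _ => ?_
  obtain ⟨r, hr, hσ⟩ : ∃ r ≤ p, p ≤ σ r := by
    by_contra! h
    have := Finset.card_le_card_of_injOn (s := Finset.Iic p) (t := Finset.Iio p) σ
      (fun r hr => by simpa using h r (by simpa using hr)) σ.injective.injOn
    simp at this
  rw [Finset.prod_eq_zero (Finset.mem_univ r), smul_zero]
  exact hu.1 _ _ (((hJ.monotone hr).trans_lt hp).trans_le (hI.monotone hσ))

theorem TotallyNonneg.allMinorsNonneg {d : ℕ} {u : Matrix (Fin d) (Fin d) ℝ}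
    (hnn : TotallyNonneg u) (hu : UTUnipotent u) : AllMinorsNonneg u := by
  intro k I J hI hJ
  rcases Nat.eq_zero_or_pos k with rfl | hk
  · simp
  by_cases h : ∀ p, I p ≤ J p
  · exact hnn k hk (by simpa using Fintype.card_le_of_injective I hI.injective) I J hI hJ h
  · push Not at h
    obtain ⟨p, hp⟩ := h
    exact (hu.det_submatrix_eq_zero hI hJ hp).ge

theorem strictMono_cornerI {d k : ℕ} (hk : k ≤ d) : StrictMono (cornerI k hk) := fun _ _ h => h

theorem strictMono_cornerJ {d k : ℕ} (hk : k ≤ d) : StrictMono (cornerJ k hk) := fun _ _ h => by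
  simpa [cornerJ] using h

/-- A totally nonnegative unipotent matrix with nonzero corner minors is totally positive. -/
theorem TotallyNonneg.totallyPositive_of_corner {d : ℕ} {u : Matrix (Fin d) (Fin d) ℝ}
    (hnn : TotallyNonneg u) (hu : UTUnipotent u)
    (hcorner : ∀ (k : ℕ) (hk : k ≤ d), 1 ≤ k → k ≤ d - 1 →
      (u.submatrix (cornerI k hk) (cornerJ k hk)).det ≠ 0) : TotallyPositive u := by
  have hA := hnn.allMinorsNonneg hu
  have corner_pos : ∀ (k : ℕ) (hk : k ≤ d),
      0 < (u.submatrix (cornerI k hk) (cornerJ k hk)).det := by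
    intro k hk
    rcases Nat.eq_zero_or_pos k with rfl | hk0
    · simp
    rcases hk.eq_or_lt with rfl | hlt
    · have hI : cornerI k hk = id := rfl
      have hJ : cornerJ k hk = id := by
        funext p
        simp [cornerJ]
      rw [hI, hJ, submatrix_id_id, det_of_isUpperTriangular fun i j h => hu.1 i j h]
      simp [hu.2]
    · exact (hA.submatrix (strictMono_cornerI hk) (strictMono_cornerJ hk)).det_nonneg.lt_of_ne'
        (hcorner k hk hk0 (by omega))
  suffices h : ∀ (k : ℕ) (I J : Fin k → Fin d), StrictMono I → StrictMono J →
      (∀ p, I p ≤ J p) → 0 < (u.submatrix I J).det from fun k _ _ => h k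
  intro k
  induction k with
  | zero => simp
  | succ n ih =>
    intro I J hI hJ hIJ
    refine hA.det_pos_of_consecutive_rows ih hJ (fun I hI hIc hIJ => ?_) I hI hIJ
    refine hA.det_pos_of_consecutive_cols ih hI (fun J hJ hJc hIJ => ?_) J hJ hIJ
    have hk : d - ((J 0 : ℕ) - (I 0 : ℕ)) ≤ d := Nat.sub_le _ _
    have h0 : (I 0 : ℕ) ≤ J 0 := hIJ 0
    have hd := (J 0).isLt
    have hIv : ∀ p, (I p : ℕ) = I 0 + p := fun p => by simpa using hIc p 0
    have hJv : ∀ p, (J p : ℕ) = J 0 + p := fun p => by simpa using hJc p 0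
    set I' : Fin (n + 1) → Fin (d - ((J 0 : ℕ) - (I 0 : ℕ))) := fun p => ⟨I p, by
      have := (J p).isLt
      rw [hJv p] at this
      rw [hIv p]
      omega⟩ with hI'
    have := (hA.submatrix (strictMono_cornerI hk) (strictMono_cornerJ hk)).det_principal_pos
      (corner_pos _ hk) (I := I') hIc
    rw [submatrix_submatrix] at this
    have h1 : cornerI _ hk ∘ I' = I := rfl
    have h2 : cornerJ _ hk ∘ I' = J := by
      funext p
      apply Fin.ext
      simp only [cornerJ, Function.comp_apply, hI']
      rw [hIv p, hJv p]
      omega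
    rwa [h1, h2] at this

/-- If a corner minor vanishes, the corresponding pair of flags is not transverse. -/
theorem map_lastBasisSpan_sup_ne_top {d k : ℕ} (u : Matrix (Fin d) (Fin d) ℝ) (hk : k ≤ d)
    (h : (u.submatrix (cornerI k hk) (cornerJ k hk)).det = 0) :
    Submodule.map (Matrix.toLin' u) (lastBasisSpan d k) ⊔ lastBasisSpan d (d - k) ≠ ⊤ := by
  obtain ⟨w, hw0, hw⟩ := exists_vecMul_eq_zero_iff.2 h
  set φ : (Fin d → ℝ) →ₗ[ℝ] ℝ := ∑ p, w p • LinearMap.proj (cornerI k hk p) with hφ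
  have hφ_apply : ∀ x, φ x = ∑ p, w p * x (cornerI k hk p) := fun x => by simp [hφ]
  intro htop
  have hle : Submodule.map (Matrix.toLin' u) (lastBasisSpan d k) ⊔ lastBasisSpan d (d - k)
      ≤ LinearMap.ker φ := by
    refine sup_le ?_ ?_
    · rw [lastBasisSpan, Submodule.map_span, Submodule.span_le]
      rintro _ ⟨_, ⟨i, hi, rfl⟩, rfl⟩
      have hi : d - k ≤ (i : ℕ) := hi
      have hq := congrFun hw ⟨i - (d - k), by omega⟩
      have hiq : cornerJ k hk ⟨i - (d - k), by omega⟩ = i := by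
        apply Fin.ext
        simp only [cornerJ]
        omega
      simpa [hφ_apply, vecMul, dotProduct, hiq] using hq
    · rw [lastBasisSpan, Submodule.span_le]
      rintro _ ⟨i, hi, rfl⟩
      have hi : d - (d - k) ≤ (i : ℕ) := hi
      simp only [SetLike.mem_coe, LinearMap.mem_ker, hφ_apply]
      refine Finset.sum_eq_zero fun p _ => ?_
      rw [Pi.single_eq_of_ne, mul_zero]
      have := p.isLt
      simp only [cornerI, ne_eq, Fin.ext_iff]
      omega
  rw [htop, top_le_iff] at hle
  refine hw0 (funext fun p => ?_)
  have h : Pi.single (cornerI k hk p) (1 : ℝ) ∈ LinearMap.ker φ := hle ▸ Submodule.mem_top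
  rw [LinearMap.mem_ker, hφ_apply] at h
  simpa [Pi.single_apply, (strictMono_cornerI hk).injective.eq_iff] using h

/-- If `u` is a totally nonnegative upper triangular
unipotent matrix that is not totally positive, then for some `1 ≤ k ≤ d - 1`
the image under `u` of the span of the last `k` standard basis vectors,
together with the span of the last `d - k` standard basis vectors, fails to
span `ℝ^d`. -/
theorem exists_image_sup_ne_top {d : ℕ}
    (u : Matrix (Fin d) (Fin d) ℝ) (hu : UTUnipotent u) (hnn : TotallyNonneg u)
    (hnp : ¬ TotallyPositive u) :
    ∃ k : ℕ, 1 ≤ k ∧ k ≤ d - 1 ∧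
      Submodule.map (Matrix.toLin' u) (lastBasisSpan d k) ⊔
        lastBasisSpan d (d - k) ≠ ⊤ := by
  by_contra! h
  refine hnp (hnn.totallyPositive_of_corner hu fun k hk h1 h2 h0 => ?_)
  exact map_lastBasisSpan_sup_ne_top u hk h0 (h k h1 h2)
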